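/- arXiv:2107.00572 — 13 statements merged into one kernel-verified Lean document; each statement's English description precedes it below -/
import Mathlib

section
/- For every generic realization w of a hypergraph orientation instance and every vertex v ∈ V, v is mandatory for w if and only if there exists a hyperedge F ∈ E with v ∈ F such that either (i) v is the minimum-weight vertex of F and w_u ∈ I_v for some u ∈ F \ {v}, or (ii) v is not the minimum-weight vertex of F and w_u ∈ I_v, where u is the minimum-weight vertex of F. -/
variable {V : Type*}

/-- `Feasible ℓ r E w Q`: `Q` is a feasible query set for the realization `w` of the
hypergraph orientation instance with intervals `I_v = (ℓ v, r v)` and hyperedges `E`: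
for every hyperedge `F ∈ E`, letting `v ∈ F` be a vertex of minimum weight, either
(a) `v ∈ Q` and every `u ∈ F \ {v}` with `w v ∈ I_u` belongs to `Q`, or
(b) `v ∉ Q` and every `u ∈ F \ {v}` with `I_u ∩ I_v ≠ ∅` belongs to `Q`
and satisfies `w u ≥ r v`. -/
def Feasible (ℓ r : V → ℝ) (E : Finset (Finset V)) (w : V → ℝ) (Q : Finset V) : Prop :=
  ∀ F ∈ E, ∀ v ∈ F, (∀ u ∈ F, w v ≤ w u) →
    ((v ∈ Q ∧ ∀ u ∈ F, u ≠ v → w v ∈ Set.Ioo (ℓ u) (r u) → u ∈ Q) ∨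
     (v ∉ Q ∧ ∀ u ∈ F, u ≠ v →
        (Set.Ioo (ℓ u) (r u) ∩ Set.Ioo (ℓ v) (r v)).Nonempty → u ∈ Q ∧ r v ≤ w u))

/-- A vertex is mandatory for `w` if it belongs to every feasible query set for `w`. -/
def Mandatory (ℓ r : V → ℝ) (E : Finset (Finset V)) (w : V → ℝ) (v : V) : Prop :=
  ∀ Q : Finset V, Feasible ℓ r E w Q → v ∈ Q

/-- For every generic realization `w` and every vertex `v`, `v` is mandatory for `w` iff
there is a hyperedge `F ∈ E` with `v ∈ F` such that either (i) `v` is the minimum-weight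
vertex of `F` and `w u ∈ I_v` for some `u ∈ F \ {v}`, or (ii) `v` is not the
minimum-weight vertex of `F` and `w u ∈ I_v`, where `u` is the minimum-weight vertex
of `F`. -/
theorem mandatory_iff [Fintype V] (ℓ r : V → ℝ) (E : Finset (Finset V))
    (hlt : ∀ v, ℓ v < r v) (hE : ∀ F ∈ E, 2 ≤ F.card)
    (w : V → ℝ) (hw : ∀ v, w v ∈ Set.Ioo (ℓ v) (r v)) (hgen : Function.Injective w)
    (v : V) :
    Mandatory ℓ r E w v ↔
      ∃ F ∈ E, v ∈ F ∧
        (((∀ x ∈ F, w v ≤ w x) ∧ ∃ u ∈ F, u ≠ v ∧ w u ∈ Set.Ioo (ℓ v) (r v)) ∨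
         (¬ (∀ x ∈ F, w v ≤ w x) ∧
            ∃ u ∈ F, (∀ x ∈ F, w u ≤ w x) ∧ w u ∈ Set.Ioo (ℓ v) (r v))) := by
  classical
  constructor
  · intro hv
    by_contra hno
    suffices h : Feasible ℓ r E w (Finset.univ.erase v) from
      Finset.notMem_erase v _ (hv _ h)
    intro F hF m hm hmin
    by_cases hmv : m = v
    · subst hmv
      refine Or.inr ⟨Finset.notMem_erase _ _, fun u hu hne _ => ⟨by simp [hne], ?_⟩⟩
      by_contra! hlt_r
      exact hno ⟨F, hF, hm, Or.inl ⟨hmin, u, hu, hne, (hw m).1.trans_le (hmin u hu), hlt_r⟩⟩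
    · refine Or.inl ⟨by simp [hmv], fun u hu _ hmem => ?_⟩
      suffices u ≠ v by simp [this]
      rintro rfl
      exact hno ⟨F, hF, hu, Or.inr
        ⟨fun h => hmv (hgen (le_antisymm (hmin u hu) (h m hm))), m, hm, hmin, hmem⟩⟩
  · rintro ⟨F, hF, hvF, ⟨hmin, u, hu, hne, hmem⟩ | ⟨hnmin, u, hu, hmin, hmem⟩⟩ Q hQ
    · rcases hQ F hF v hvF hmin with h | h
      · exact h.1
      · exact absurd hmem.2 (not_lt.mpr (h.2 u hu hne ⟨w u, hw u, hmem⟩).2)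
    · have hne : v ≠ u := by
        rintro rfl
        exact hnmin hmin
      rcases hQ F hF u hu hmin with h | h
      · exact h.2 v hvF hne hmem
      · exact (h.2 v hvF hne ⟨w u, hmem, hw u⟩).1
end

section
/- Let F ∈ E be a hyperedge, let v₁ ∈ F be a leftmost vertex of F (i.e., ℓ_{v₁} ≤ ℓ_u for all u ∈ F), and let v_i ∈ F \ {v₁} satisfy I_{v₁} ∩ I_{v_i} ≠ ∅. Then {v₁, v_i} is a witness set: for every generic realization w, every feasible query set Q for w satisfies Q ∩ {v₁, v_i} ≠ ∅. -/
variable {V : Type*}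

/-- Let `F ∈ E` be a hyperedge, `v₁ ∈ F` a leftmost vertex of `F`, and `vᵢ ∈ F \ {v₁}`
with `I_{v₁} ∩ I_{vᵢ} ≠ ∅`. Then `{v₁, vᵢ}` is a witness set: for every generic
realization `w`, every feasible query set `Q` for `w` intersects `{v₁, vᵢ}`. -/
theorem witness_set [Fintype V] (ℓ r : V → ℝ) (E : Finset (Finset V))
    (hlt : ∀ v, ℓ v < r v) (hE : ∀ F ∈ E, 2 ≤ F.card)
    (F : Finset V) (hF : F ∈ E)
    (v₁ : V) (hv₁ : v₁ ∈ F) (hleft : ∀ u ∈ F, ℓ v₁ ≤ ℓ u)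
    (vi : V) (hvi : vi ∈ F) (hne : vi ≠ v₁)
    (hover : (Set.Ioo (ℓ v₁) (r v₁) ∩ Set.Ioo (ℓ vi) (r vi)).Nonempty)
    (w : V → ℝ) (hw : ∀ v, w v ∈ Set.Ioo (ℓ v) (r v)) (hgen : Function.Injective w)
    (Q : Finset V) (hQ : Feasible ℓ r E w Q) :
    v₁ ∈ Q ∨ vi ∈ Q := by
  obtain ⟨v, hv, hmin⟩ := F.exists_min_image w ⟨v₁, hv₁⟩
  have hmem : w v ∈ Set.Ioo (ℓ v₁) (r v₁) :=
    ⟨(hleft v hv).trans_lt (hw v).1, (hmin v₁ hv₁).trans_lt (hw v₁).2⟩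
  rcases eq_or_ne v₁ v with rfl | hv₁v
  · rcases hQ F hF v₁ hv hmin with ⟨h, -⟩ | ⟨-, h⟩
    · exact Or.inl h
    · exact Or.inr (h vi hvi hne (by rwa [Set.inter_comm])).1
  · rcases hQ F hF v hv hmin with ⟨-, h⟩ | ⟨-, h⟩
    · exact Or.inl (h v₁ hv₁ hv₁v hmem)
    · exact Or.inl (h v₁ hv₁ hv₁v ⟨w v, hmem, hw v⟩).1
end

section
/- For every generic realization w of a hypergraph orientation instance, every feasible query set Q for w is a vertex cover of the vertex cover instance Ḡ, i.e., every edge of Ḡ has at least one endpoint in Q. -/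
variable {V : Type*}

/-- `{v, u}` is an edge of the vertex cover instance `Ḡ` of the hypergraph `(V, E)`:
there is a hyperedge `F ∈ E` with `v, u ∈ F` such that `v` is a leftmost vertex of `F`
and `I_v ∩ I_u ≠ ∅`. -/
def EbarAdj (ℓ r : V → ℝ) (E : Finset (Finset V)) (v u : V) : Prop :=
  v ≠ u ∧ ∃ F ∈ E, v ∈ F ∧ u ∈ F ∧ (∀ x ∈ F, ℓ v ≤ ℓ x) ∧
    (Set.Ioo (ℓ v) (r v) ∩ Set.Ioo (ℓ u) (r u)).Nonempty

/-- For every generic realization `w`, every feasible query set `Q` for `w` is a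
vertex cover of the vertex cover instance `Ḡ`: every edge of `Ḡ` has an endpoint
in `Q`. -/
theorem feasible_is_vertex_cover [Fintype V] (ℓ r : V → ℝ) (E : Finset (Finset V))
    (hlt : ∀ v, ℓ v < r v) (hE : ∀ F ∈ E, 2 ≤ F.card)
    (w : V → ℝ) (hw : ∀ v, w v ∈ Set.Ioo (ℓ v) (r v)) (hgen : Function.Injective w)
    (Q : Finset V) (hQ : Feasible ℓ r E w Q) :
    ∀ v u : V, EbarAdj ℓ r E v u → v ∈ Q ∨ u ∈ Q := by
  rintro v u ⟨hvu, F, hF, hvF, huF, hleft, hint⟩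
  obtain ⟨m, hmF, hmin⟩ := F.exists_min_image w ⟨v, hvF⟩
  -- The minimum of a hyperedge lies in the interval of its leftmost vertex.
  have hmv : w m ∈ Set.Ioo (ℓ v) (r v) :=
    ⟨(hleft m hmF).trans_lt (hw m).1, (hmin v hvF).trans_lt (hw v).2⟩
  by_cases hm : m = v
  · subst hm
    rcases hQ F hF m hmF hmin with ⟨hmQ, -⟩ | ⟨-, h⟩
    · exact Or.inl hmQ
    · exact Or.inr (h u huF hvu.symm (Set.inter_comm _ _ ▸ hint)).1
  · left
    rcases hQ F hF m hmF hmin with ⟨-, h⟩ | ⟨-, h⟩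
    · exact h v hvF (Ne.symm hm) hmv
    · exact (h v hvF (Ne.symm hm) ⟨w m, hmv, hw m⟩).1
end

section
/- Let w be a generic realization of a preprocessed hypergraph orientation instance with query costs c_v > 0, let M be the set of vertices mandatory for w, and let VC_M be a vertex cover of minimum total cost of the induced subgraph Ḡ[V \ M] of the vertex cover instance. Then M ∪ VC_M is a feasible query set for w, and every feasible query set Q for w satisfies c(Q) ≥ c(M ∪ VC_M), where c(S) = Σ_{v∈S} c_v. -/
variable {V : Type*}

/-- If `v` is the minimum of a hyperedge and `w v` lies in the interval of another vertex `u` of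
it, then every feasible query set contains `u`. -/
theorem mandatory_of_min_mem {ℓ r : V → ℝ} {E : Finset (Finset V)} {w : V → ℝ}
    (hw : ∀ v, w v ∈ Set.Ioo (ℓ v) (r v)) {F : Finset V} (hF : F ∈ E) {v u : V}
    (hv : v ∈ F) (hmin : ∀ x ∈ F, w v ≤ w x) (hu : u ∈ F) (huv : u ≠ v)
    (h : w v ∈ Set.Ioo (ℓ u) (r u)) : Mandatory ℓ r E w u := by
  intro Q hQ
  rcases hQ F hF v hv hmin with ⟨-, hQ'⟩ | ⟨-, hQ'⟩
  · exact hQ' u hu huv h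
  · exact (hQ' u hu huv ⟨w v, h, hw v⟩).1

/-- If `v` is the minimum of a hyperedge and its interval contains the value of another vertex
of the hyperedge, then every feasible query set contains `v`. -/
theorem mandatory_min_of_mem {ℓ r : V → ℝ} {E : Finset (Finset V)} {w : V → ℝ}
    (hw : ∀ v, w v ∈ Set.Ioo (ℓ v) (r v)) {F : Finset V} (hF : F ∈ E) {v u : V}
    (hv : v ∈ F) (hmin : ∀ x ∈ F, w v ≤ w x) (hu : u ∈ F) (huv : u ≠ v)
    (h : w u < r v) : Mandatory ℓ r E w v := by
  intro Q hQ
  rcases hQ F hF v hv hmin with ⟨hvQ, -⟩ | ⟨-, hQ'⟩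
  · exact hvQ
  · have hwu : w u ∈ Set.Ioo (ℓ v) (r v) := ⟨(hw v).1.trans_le (hmin u hu), h⟩
    exact absurd (hQ' u hu huv ⟨w u, hw u, hwu⟩).2 h.not_ge

/-- Every feasible query set is a vertex cover of the vertex cover instance. -/
theorem Feasible.covers {ℓ r : V → ℝ} {E : Finset (Finset V)} {w : V → ℝ}
    (hw : ∀ v, w v ∈ Set.Ioo (ℓ v) (r v)) {Q : Finset V} (hQ : Feasible ℓ r E w Q)
    {x y : V} (hxy : EbarAdj ℓ r E x y) : x ∈ Q ∨ y ∈ Q := by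
  obtain ⟨hne, F, hF, hx, hy, hleft, hint⟩ := hxy
  obtain ⟨v, hv, hmin⟩ := F.exists_min_image w ⟨x, hx⟩
  by_cases hxv : x = v
  · subst hxv
    rcases hQ F hF x hv hmin with ⟨hxQ, -⟩ | ⟨-, hQ'⟩
    · exact Or.inl hxQ
    · exact Or.inr (hQ' y hy hne.symm (by rwa [Set.inter_comm])).1
  · exact Or.inl (mandatory_of_min_mem hw hF hv hmin hx hxv
      ⟨(hleft v hv).trans_lt (hw v).1, (hmin x hx).trans_lt (hw x).2⟩ Q hQ)

/-- Let `w` be a generic realization of a preprocessed hypergraph orientation instance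
with query costs `c v > 0`, let `M` be the set of vertices mandatory for `w`, and let
`VCM` be a minimum-cost vertex cover of the induced subgraph `Ḡ[V \ M]` of the vertex
cover instance. Then `M ∪ VCM` is a feasible query set for `w`, and every feasible
query set `Q` for `w` satisfies `c(Q) ≥ c(M ∪ VCM)`. -/
theorem optimal_query_set [Fintype V] [DecidableEq V]
    (ℓ r c : V → ℝ) (E : Finset (Finset V))
    (hlt : ∀ v, ℓ v < r v) (hc : ∀ v, 0 < c v) (hE : ∀ F ∈ E, 2 ≤ F.card)
    (hpre : ∀ F ∈ E, ∃ v₁ ∈ F, ∀ u ∈ F, u ≠ v₁ →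
      ℓ v₁ ≤ ℓ u ∧ (Set.Ioo (ℓ v₁) (r v₁) ∩ Set.Ioo (ℓ u) (r u)).Nonempty ∧
        ¬ Set.Ioo (ℓ u) (r u) ⊆ Set.Ioo (ℓ v₁) (r v₁))
    (w : V → ℝ) (hw : ∀ v, w v ∈ Set.Ioo (ℓ v) (r v)) (hgen : Function.Injective w)
    (M : Finset V) (hM : ∀ v, v ∈ M ↔ Mandatory ℓ r E w v)
    (VCM : Finset V) (hVCMsub : ∀ v ∈ VCM, v ∉ M)
    (hVCMcov : ∀ x y : V, EbarAdj ℓ r E x y → x ∉ M → y ∉ M → x ∈ VCM ∨ y ∈ VCM)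
    (hVCMmin : ∀ C : Finset V, (∀ v ∈ C, v ∉ M) →
      (∀ x y : V, EbarAdj ℓ r E x y → x ∉ M → y ∉ M → x ∈ C ∨ y ∈ C) →
      ∑ v ∈ VCM, c v ≤ ∑ v ∈ C, c v) :
    Feasible ℓ r E w (M ∪ VCM) ∧
      ∀ Q : Finset V, Feasible ℓ r E w Q →
        ∑ v ∈ M ∪ VCM, c v ≤ ∑ v ∈ Q, c v := by
  constructor
  · intro F hF v hv hmin
    have hmem : ∀ u ∈ F, u ≠ v → w v ∈ Set.Ioo (ℓ u) (r u) → u ∈ M ∪ VCM := fun u hu huv h =>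
      Finset.mem_union_left _ ((hM u).2 (mandatory_of_min_mem hw hF hv hmin hu huv h))
    by_cases hvQ : v ∈ M ∪ VCM
    · exact Or.inl ⟨hvQ, hmem⟩
    · obtain ⟨hvM, hvC⟩ := not_or.1 (mt Finset.mem_union.2 hvQ)
      have hge : ∀ u ∈ F, u ≠ v → r v ≤ w u := fun u hu huv => le_of_not_gt fun h =>
        hvM ((hM v).2 (mandatory_min_of_mem hw hF hv hmin hu huv h))
      obtain ⟨v₁, hv₁, hleft⟩ := hpre F hF
      have hvv₁ : v = v₁ := by
        by_contra hne
        obtain ⟨hl, -, hsub⟩ := hleft v hv hne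
        exact hsub (Set.Ioo_subset_Ioo hl
          ((hge v₁ hv₁ (Ne.symm hne)).trans (hw v₁).2.le))
      subst hvv₁
      have hmost : ∀ x ∈ F, ℓ v ≤ ℓ x := fun x hx => by
        rcases eq_or_ne x v with rfl | hxv
        · exact le_rfl
        · exact (hleft x hx hxv).1
      refine Or.inr ⟨hvQ, fun u hu huv hint => ⟨?_, hge u hu huv⟩⟩
      by_cases huM : u ∈ M
      · exact Finset.mem_union_left _ huM
      · have hadj : EbarAdj ℓ r E v u :=
          ⟨huv.symm, F, hF, hv, hu, hmost, by rwa [Set.inter_comm]⟩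
        exact Finset.mem_union_right _ ((hVCMcov v u hadj hvM huM).resolve_left hvC)
  · intro Q hQ
    have hMQ : M ⊆ Q := fun v hv => (hM v).1 hv Q hQ
    have hmin := hVCMmin (Q \ M) (fun v hv => (Finset.mem_sdiff.1 hv).2) fun x y hxy hx hy =>
      (hQ.covers hw hxy).imp (fun h => Finset.mem_sdiff.2 ⟨h, hx⟩)
        (fun h => Finset.mem_sdiff.2 ⟨h, hy⟩)
    rw [Finset.sum_union (Finset.disjoint_right.2 hVCMsub), ← Finset.sum_sdiff hMQ]
    linarith
end

section
/- Let S₁, …, S_k be a partition of the vertex set V of a hypergraph orientation instance, let each μ_v be an atomless Borel probability measure on ℝ with μ_v(I_v) = 1, and let μ be the product measure on realizations. For a realization w, let OPT(w) be the minimum of c(Q) over all feasible query sets Q for w, and for S ⊆ V let OPT_S(w) be the minimum of c(Q ∩ S) over all feasible query sets Q for w (with c(S) = Σ_{v∈S} c_v). Then μ-almost every realization is generic, for every generic w one has OPT(w) ≥ Σ_{i=1}^k OPT_{S_i}(w), and consequently ∫ OPT dμ ≥ Σ_{i=1}^k ∫ OPT_{S_i} dμ. -/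
open MeasureTheory

variable {V : Type*}

/-- The minimum cost of a feasible query set for `w`. -/
noncomputable def OPT (ℓ r c : V → ℝ) (E : Finset (Finset V)) (w : V → ℝ) : ℝ :=
  sInf {x : ℝ | ∃ Q : Finset V, Feasible ℓ r E w Q ∧ x = ∑ v ∈ Q, c v}

/-- The minimum, over feasible query sets `Q` for `w`, of the cost of `Q ∩ S`. -/
noncomputable def OPTS [DecidableEq V] (ℓ r c : V → ℝ) (E : Finset (Finset V))
    (S : Finset V) (w : V → ℝ) : ℝ :=
  sInf {x : ℝ | ∃ Q : Finset V, Feasible ℓ r E w Q ∧ x = ∑ v ∈ Q ∩ S, c v}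

theorem feasible_univ [Fintype V] (ℓ r : V → ℝ) (E : Finset (Finset V)) (w : V → ℝ) :
    Feasible ℓ r E w Finset.univ :=
  fun _ _ v _ _ => Or.inl ⟨Finset.mem_univ v, fun u _ _ _ => Finset.mem_univ u⟩

theorem OPT_eq_OPTS_univ [Fintype V] [DecidableEq V] (ℓ r c : V → ℝ) (E : Finset (Finset V))
    (w : V → ℝ) : OPT ℓ r c E w = OPTS ℓ r c E Finset.univ w := by
  simp [OPT, OPTS]

theorem finite_feasible_costs [Finite V] (ℓ r : V → ℝ) (E : Finset (Finset V)) (w : V → ℝ)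
    (g : Finset V → ℝ) : {x : ℝ | ∃ Q : Finset V, Feasible ℓ r E w Q ∧ x = g Q}.Finite :=
  (Set.finite_range g).subset (by rintro _ ⟨Q, -, rfl⟩; exact ⟨Q, rfl⟩)

/-- The minimum defining `OPT` is attained. -/
theorem exists_feasible_cost_eq_OPT [Fintype V] (ℓ r c : V → ℝ) (E : Finset (Finset V))
    (w : V → ℝ) : ∃ Q : Finset V, Feasible ℓ r E w Q ∧ OPT ℓ r c E w = ∑ v ∈ Q, c v :=
  Set.Nonempty.csInf_mem
    (s := {x : ℝ | ∃ Q : Finset V, Feasible ℓ r E w Q ∧ x = ∑ v ∈ Q, c v})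
    ⟨_, Finset.univ, feasible_univ ℓ r E w, rfl⟩
    (finite_feasible_costs ℓ r E w fun Q => ∑ v ∈ Q, c v)

theorem OPTS_le [Finite V] [DecidableEq V] {ℓ r : V → ℝ} (c : V → ℝ) {E : Finset (Finset V)}
    {w : V → ℝ} {Q : Finset V} (hQ : Feasible ℓ r E w Q) (S : Finset V) :
    OPTS ℓ r c E S w ≤ ∑ v ∈ Q ∩ S, c v :=
  csInf_le (finite_feasible_costs ℓ r E w fun Q => ∑ v ∈ Q ∩ S, c v).bddBelow ⟨Q, hQ, rfl⟩

theorem sum_OPTS_le_OPT [Fintype V] [DecidableEq V] {ι : Type*} [Fintype ι]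
    (ℓ r c : V → ℝ) (E : Finset (Finset V)) (S : ι → Finset V)
    (hdisj : ∀ i j : ι, i ≠ j → Disjoint (S i) (S j)) (hcover : ∀ v : V, ∃ i : ι, v ∈ S i)
    (w : V → ℝ) : ∑ i, OPTS ℓ r c E (S i) w ≤ OPT ℓ r c E w := by
  obtain ⟨Q, hQ, hcost⟩ := exists_feasible_cost_eq_OPT ℓ r c E w
  have hunion : Q = Finset.univ.biUnion fun i => Q ∩ S i := by
    ext v
    simpa using fun _ => hcover v
  calc ∑ i, OPTS ℓ r c E (S i) w ≤ ∑ i, ∑ v ∈ Q ∩ S i, c v :=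
        Finset.sum_le_sum fun i _ => OPTS_le c hQ (S i)
    _ = ∑ v ∈ Finset.univ.biUnion fun i => Q ∩ S i, c v :=
        (Finset.sum_biUnion fun i _ j _ hij =>
          (hdisj i j hij).mono Finset.inter_subset_right Finset.inter_subset_right).symm
    _ = OPT ℓ r c E w := by rw [← hunion, hcost]

theorem measurableSet_feasible [Finite V] (ℓ r : V → ℝ) (E : Finset (Finset V))
    (Q : Finset V) : MeasurableSet {w : V → ℝ | Feasible ℓ r E w Q} := by
  have hle (u v : V) : MeasurableSet {w : V → ℝ | w u ≤ w v} :=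
    measurableSet_le (measurable_pi_apply u) (measurable_pi_apply v)
  have hIoo (u v : V) : MeasurableSet {w : V → ℝ | w v ∈ Set.Ioo (ℓ u) (r u)} :=
    measurable_pi_apply v measurableSet_Ioo
  have hge (u v : V) : MeasurableSet {w : V → ℝ | r v ≤ w u} :=
    measurableSet_le measurable_const (measurable_pi_apply u)
  simp only [measurableSet_setOfPred] at *
  unfold Feasible
  refine .forall fun F => measurable_const.imp <| .forall fun v => measurable_const.imp <|
    .imp (.forall fun u => measurable_const.imp (hle v u)) (.or ?_ ?_)
  · exact measurable_const.and <| .forall fun u => measurable_const.imp <|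
      measurable_const.imp <| (hIoo u v).imp measurable_const
  · exact measurable_const.and <| .forall fun u => measurable_const.imp <|
      measurable_const.imp <| measurable_const.imp <| measurable_const.and (hge u v)

/-- A real function that factors measurably through a finite discrete space is integrable. -/
theorem integrable_comp_of_finite {α β : Type*} [MeasurableSpace α] [MeasurableSpace β]
    [Finite β] [MeasurableSingletonClass β] {μ : Measure α} [IsFiniteMeasure μ] (g : β → ℝ)
    {f : α → β} (hf : Measurable f) : Integrable (fun x => g (f x)) μ := by
  obtain ⟨C, hC⟩ := (Set.finite_range fun b => ‖g b‖).bddAbove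
  exact .of_bound ((measurable_of_finite g).comp hf).aestronglyMeasurable C
    (.of_forall fun x => hC ⟨f x, rfl⟩)

theorem integrable_OPTS [Finite V] [DecidableEq V] (ℓ r c : V → ℝ) (E : Finset (Finset V))
    (S : Finset V) (μ : Measure (V → ℝ)) [IsFiniteMeasure μ] :
    Integrable (OPTS ℓ r c E S) μ :=
  integrable_comp_of_finite
    (fun P : Finset V → Prop => sInf {x : ℝ | ∃ Q, P Q ∧ x = ∑ v ∈ Q ∩ S, c v})
    (f := fun w Q => Feasible ℓ r E w Q)
    (measurable_pi_lambda _ fun Q => measurableSet_setOfPred.1 (measurableSet_feasible ℓ r E Q))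

theorem ae_pi_injective {ι : Type*} [Fintype ι] (μ : ι → Measure ℝ)
    [∀ i, IsProbabilityMeasure (μ i)] (hμ : ∀ i x, μ i {x} = 0) :
    ∀ᵐ w ∂Measure.pi μ, Function.Injective w := by
  have hne (i j : ι) (hij : i ≠ j) : ∀ᵐ w ∂Measure.pi μ, w i ≠ w j := by
    have hind := (ProbabilityTheory.iIndepFun_pi (μ := μ) (X := fun _ x => x)
      fun _ => aemeasurable_id).indepFun hij
    rw [ProbabilityTheory.indepFun_iff_map_prod_eq_prod_map_map
      (measurable_pi_apply i).aemeasurable (measurable_pi_apply j).aemeasurable,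
      (measurePreserving_eval μ i).map_eq, (measurePreserving_eval μ j).map_eq] at hind
    have hdiag : ∀ᵐ p ∂(μ i).prod (μ j), p.1 ≠ p.2 := by
      have hs : MeasurableSet {p : ℝ × ℝ | p.1 = p.2} :=
        measurableSet_eq_fun measurable_fst measurable_snd
      rw [ae_iff]
      simp only [not_not]
      refine (Measure.measure_prod_null hs).2 (.of_forall fun x => ?_)
      simpa [Set.preimage, eq_comm] using hμ j x
    rw [← hind] at hdiag
    exact ae_of_ae_map ((measurable_pi_apply i).prodMk (measurable_pi_apply j)).aemeasurable hdiag
  have hall : ∀ᵐ w ∂Measure.pi μ, ∀ i j : ι, i ≠ j → w i ≠ w j := by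
    simpa only [ae_all_iff] using hne
  filter_upwards [hall] with w hw i j hij
  exact not_imp_not.1 (hw i j) hij

/-- Let `S 0, …, S (k-1)` be a partition of `V`, let each `μv v` be an atomless Borel
probability measure on `ℝ` with `μv v (I v) = 1`, and let `μ` be the product measure on
realizations. Then μ-almost every realization is generic, for every generic realization
`w` one has `OPT w ≥ Σ_i OPT_{S i} w`, and consequently
`∫ OPT dμ ≥ Σ_i ∫ OPT_{S i} dμ`. -/
theorem opt_partitioning [Fintype V] [DecidableEq V]
    (ℓ r c : V → ℝ) (E : Finset (Finset V))
    (hlt : ∀ v, ℓ v < r v) (hc : ∀ v, 0 < c v) (hE : ∀ F ∈ E, 2 ≤ F.card)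
    (k : ℕ) (S : Fin k → Finset V)
    (hdisj : ∀ i j : Fin k, i ≠ j → Disjoint (S i) (S j))
    (hcover : ∀ v : V, ∃ i : Fin k, v ∈ S i)
    (μv : V → Measure ℝ) [∀ v, IsProbabilityMeasure (μv v)]
    (hatomless : ∀ v : V, ∀ x : ℝ, μv v {x} = 0)
    (hsupp : ∀ v : V, μv v (Set.Ioo (ℓ v) (r v)) = 1) :
    (∀ᵐ w ∂(Measure.pi μv), Function.Injective w) ∧
    (∀ w : V → ℝ, (∀ v, w v ∈ Set.Ioo (ℓ v) (r v)) → Function.Injective w →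
      OPT ℓ r c E w ≥ ∑ i : Fin k, OPTS ℓ r c E (S i) w) ∧
    (∫ w, OPT ℓ r c E w ∂(Measure.pi μv) ≥
      ∑ i : Fin k, ∫ w, OPTS ℓ r c E (S i) w ∂(Measure.pi μv)) := by
  have hle := sum_OPTS_le_OPT ℓ r c E S hdisj hcover
  refine ⟨ae_pi_injective μv hatomless, fun w _ _ => hle w, ?_⟩
  have hint (i : Fin k) := integrable_OPTS ℓ r c E (S i) (Measure.pi μv)
  have hOPT : Integrable (OPT ℓ r c E) (Measure.pi μv) := by
    rw [funext (OPT_eq_OPTS_univ ℓ r c E)]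
    exact integrable_OPTS ℓ r c E Finset.univ (Measure.pi μv)
  rw [ge_iff_le, ← integral_finsetSum _ fun i _ => hint i]
  exact integral_mono (integrable_finsetSum _ fun i _ => hint i) hOPT hle
end

section
/- Consider a graph orientation instance, i.e., every hyperedge has exactly two vertices, and assume I_u ∩ I_v ≠ ∅ for every edge {u, v}. Let each μ_v be an atomless Borel probability measure on ℝ with μ_v(I_v) = 1 and let μ be the product measure on realizations. Then for every vertex v, the μ-measure of the set of generic realizations w for which v is mandatory equals 1 − Π_{u : {u,v} ∈ E} (1 − μ_u(I_v)). In particular, for a generic realization w of a graph instance, v is mandatory if and only if w_u ∈ I_v for some neighbor u of v. -/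
open MeasureTheory

variable {V : Type*}

theorem mandatory_iff_exists_neighbor [Fintype V] [DecidableEq V]
    (ℓ r : V → ℝ) (E : Finset (Finset V)) (hcard : ∀ F ∈ E, F.card = 2)
    (hover : ∀ u v : V, ({u, v} : Finset V) ∈ E →
      (Set.Ioo (ℓ u) (r u) ∩ Set.Ioo (ℓ v) (r v)).Nonempty)
    (v : V) (w : V → ℝ) (hw : ∀ x, w x ∈ Set.Ioo (ℓ x) (r x)) :
    Mandatory ℓ r E w v ↔ ∃ u : V, ({u, v} : Finset V) ∈ E ∧ w u ∈ Set.Ioo (ℓ v) (r v) := by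
  constructor
  · intro hm
    by_contra! hno
    have edge_eq : ∀ F ∈ E, ∀ a ∈ F, ∀ b ∈ F, a ≠ b → F = {a, b} := by
      intro F hF a ha b hb hab
      refine (Finset.eq_of_subset_of_card_le ?_ ?_).symm
      · simp [Finset.insert_subset_iff, ha, hb]
      · rw [hcard F hF, Finset.card_pair hab]
    have hfeas : Feasible ℓ r E w (Finset.univ.erase v) := by
      intro F hF a ha hmin
      by_cases hav : a = v
      · subst hav
        refine Or.inr ⟨by simp, fun u hu hua _ => ⟨by simp [hua], ?_⟩⟩
        have hout := hno u (edge_eq F hF u hu a ha hua ▸ hF)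
        by_contra! hlt
        exact hout ⟨(hw a).1.trans_le (hmin u hu), hlt⟩
      · refine Or.inl ⟨by simp [hav], fun u hu hua hwa => ?_⟩
        have huv : u ≠ v := by
          rintro rfl
          exact hno a (edge_eq F hF a ha u hu hua.symm ▸ hF) hwa
        simp [huv]
    simpa using hm _ hfeas
  · rintro ⟨u, hE, hu⟩ Q hQ
    have huv : u ≠ v := by
      rintro rfl
      simpa using hcard _ hE
    rcases le_total (w u) (w v) with h | h
    · rcases hQ _ hE u (by simp) (by simp [h]) with ⟨_, h2⟩ | ⟨_, h2⟩
      · exact h2 v (by simp) huv.symm hu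
      · exact (h2 v (by simp) huv.symm (Set.inter_comm _ _ ▸ hover u v hE)).1
    · rcases hQ _ hE v (by simp) (by simp [h]) with ⟨h1, _⟩ | ⟨_, h2⟩
      · exact h1
      · exact absurd (h2 u (by simp) huv (hover u v hE)).2 (not_le.mpr hu.2)

theorem ae_injective_pi [Fintype V] (μv : V → Measure ℝ) [∀ v, IsProbabilityMeasure (μv v)]
    [∀ v, NullSingletonClass (μv v)] : ∀ᵐ w ∂Measure.pi μv, Function.Injective w := by
  have hpair : ∀ x y : V, x ≠ y → ∀ᵐ w ∂Measure.pi μv, w x ≠ w y := by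
    intro x y hxy
    have hind := (ProbabilityTheory.iIndepFun_pi (μ := μv) (X := fun _ => id)
      (fun _ => aemeasurable_id)).indepFun hxy
    have hmap := (ProbabilityTheory.indepFun_iff_map_prod_eq_prod_map_map
      (measurable_pi_apply x).aemeasurable (measurable_pi_apply y).aemeasurable).1 hind
    rw [(measurePreserving_eval μv x).map_eq, (measurePreserving_eval μv y).map_eq] at hmap
    have hdiag : ∀ᵐ p ∂(μv x).prod (μv y), p.1 ≠ p.2 := by
      have hmeas : MeasurableSet {p : ℝ × ℝ | p.1 = p.2} :=
        measurableSet_eq_fun measurable_fst measurable_snd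
      rw [ae_iff]
      simp only [ne_eq, not_not]
      rw [Measure.measure_prod_null hmeas]
      refine Filter.Eventually.of_forall fun a => ?_
      simp [Set.preimage]
    rw [← hmap] at hdiag
    exact ae_of_ae_map (f := fun w : V → ℝ => (w x, w y)) (by fun_prop) hdiag
  have hall : ∀ᵐ w ∂Measure.pi μv, ∀ x y : V, x ≠ y → w x ≠ w y := by
    simp only [ae_all_iff]
    exact hpair
  filter_upwards [hall] with w hw x y hxy
  by_contra hne
  exact hw x y hne hxy

/-- Consider a graph orientation instance (every hyperedge has exactly two vertices,
with overlapping intervals for each edge), with `μv v` an atomless Borel probability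
measure on `ℝ` with `μv v (I v) = 1`, and `μ` the product measure on realizations.
Then for every vertex `v`, the `μ`-measure of the set of generic realizations `w` for
which `v` is mandatory equals `1 − Π_{u : {u,v} ∈ E} (1 − μv u (I v))`.  In particular,
for a generic realization `w`, `v` is mandatory iff `w u ∈ I v` for some neighbor `u`
of `v`. -/
theorem mandatory_probability_graph [Fintype V] [DecidableEq V]
    (ℓ r : V → ℝ) (E : Finset (Finset V))
    (hlt : ∀ v, ℓ v < r v) (hcard : ∀ F ∈ E, F.card = 2)
    (hover : ∀ u v : V, ({u, v} : Finset V) ∈ E →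
      (Set.Ioo (ℓ u) (r u) ∩ Set.Ioo (ℓ v) (r v)).Nonempty)
    (μv : V → Measure ℝ) [∀ v, IsProbabilityMeasure (μv v)]
    (hatomless : ∀ v : V, ∀ x : ℝ, μv v {x} = 0)
    (hsupp : ∀ v : V, μv v (Set.Ioo (ℓ v) (r v)) = 1)
    (v : V) :
    Measure.pi μv {w : V → ℝ | Function.Injective w ∧ Mandatory ℓ r E w v} =
      1 - ∏ u ∈ Finset.univ.filter (fun u : V => ({u, v} : Finset V) ∈ E),
        (1 - μv u (Set.Ioo (ℓ v) (r v))) ∧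
    ∀ w : V → ℝ, (∀ x, w x ∈ Set.Ioo (ℓ x) (r x)) → Function.Injective w →
      (Mandatory ℓ r E w v ↔
        ∃ u : V, ({u, v} : Finset V) ∈ E ∧ w u ∈ Set.Ioo (ℓ v) (r v)) := by
  refine ⟨?_, fun w hw _ => mandatory_iff_exists_neighbor ℓ r E hcard hover v w hw⟩
  have : ∀ v, NullSingletonClass (μv v) := fun v => ⟨hatomless v⟩
  set N := Finset.univ.filter (fun u : V => ({u, v} : Finset V) ∈ E) with hN
  set A : Set (V → ℝ) :=
    Set.univ.pi fun u => if u ∈ N then (Set.Ioo (ℓ v) (r v))ᶜ else Set.univ with hA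
  have hAmeas : MeasurableSet A := by
    refine MeasurableSet.univ_pi fun u => ?_
    split_ifs
    · exact measurableSet_Ioo.compl
    · exact MeasurableSet.univ
  have hsupp_ae : ∀ᵐ w ∂Measure.pi μv, ∀ x, w x ∈ Set.Ioo (ℓ x) (r x) := by
    rw [ae_all_iff]
    intro x
    exact (measurePreserving_eval μv x).quasiMeasurePreserving.ae
      ((mem_ae_iff_prob_eq_one measurableSet_Ioo).2 (hsupp x))
  have hset : Measure.pi μv {w : V → ℝ | Function.Injective w ∧ Mandatory ℓ r E w v} =
      Measure.pi μv Aᶜ := by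
    refine measure_congr (Filter.Eventually.set_eq ?_)
    filter_upwards [ae_injective_pi μv, hsupp_ae] with w hinj hw
    rw [mandatory_iff_exists_neighbor ℓ r E hcard hover v w hw]
    simp only [hinj, true_and, hA, Set.mem_compl_iff, Set.mem_univ_pi, not_forall]
    refine exists_congr fun u => ?_
    by_cases hu : ({u, v} : Finset V) ∈ E <;> simp [hN, hu]
  rw [hset, prob_compl_eq_one_sub hAmeas, hA, Measure.pi_pi]
  congr 1
  rw [← Finset.prod_subset (Finset.subset_univ N)]
  · refine Finset.prod_congr rfl fun u hu => ?_
    rw [if_pos hu, prob_compl_eq_one_sub measurableSet_Ioo]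
  · intro u _ hu
    rw [if_neg hu, measure_univ]
end

section
/- Let G = (V, E) be a finite simple graph with vertex costs c_v ≥ 0, and let x* : V → ℝ take values in {0, 1/2, 1}, satisfy x*_u + x*_v ≥ 1 for every edge {u, v} ∈ E, and minimize Σ_{v∈V} c_v·x_v among all x : V → [0, ∞) with x_u + x_v ≥ 1 for every edge. Let V₁ = {v : x*_v = 1} and V₀ = {v : x*_v = 0}, and let G' be the bipartite graph on V₁ ∪ V₀ whose edges are the edges of G with one endpoint in V₁ and the other in V₀. Then V₁ is a minimum-cost vertex cover of G': V₁ covers every edge of G', and every vertex cover C of G' satisfies Σ_{v∈C} c_v ≥ Σ_{v∈V₁} c_v. -/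
open scoped Classical

/-- Let `G` be a finite simple graph with vertex costs `c v ≥ 0`, and let `x*` take
values in `{0, 1/2, 1}`, satisfy `x* u + x* v ≥ 1` for every edge, and minimize
`Σ_v c v · x v` among all nonnegative `x` with `x u + x v ≥ 1` for every edge.
Let `V₁ = {v : x* v = 1}` and `V₀ = {v : x* v = 0}`, and let `G'` be the bipartite
graph on `V₁ ∪ V₀` whose edges are the edges of `G` with one endpoint in `V₁` and the
other in `V₀`.  Then `V₁` is a minimum-cost vertex cover of `G'`: `V₁` covers every
edge of `G'`, and every vertex cover `C` of `G'` satisfies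
`Σ_{v∈C} c v ≥ Σ_{v∈V₁} c v`. -/
theorem lp_halfintegral_V1_min_cover {V : Type*} [Fintype V]
    (G : SimpleGraph V) (c : V → ℝ) (hc : ∀ v, 0 ≤ c v)
    (xstar : V → ℝ)
    (hval : ∀ v, xstar v = 0 ∨ xstar v = 1 / 2 ∨ xstar v = 1)
    (hfeas : ∀ u v : V, G.Adj u v → 1 ≤ xstar u + xstar v)
    (hopt : ∀ y : V → ℝ, (∀ v, 0 ≤ y v) → (∀ u v : V, G.Adj u v → 1 ≤ y u + y v) →
      ∑ v : V, c v * xstar v ≤ ∑ v : V, c v * y v) :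
    (∀ u v : V, G.Adj u v → xstar u = 1 → xstar v = 0 →
      u ∈ Finset.univ.filter (fun z : V => xstar z = 1) ∨
      v ∈ Finset.univ.filter (fun z : V => xstar z = 1)) ∧
    ∀ C : Finset V,
      (∀ u v : V, G.Adj u v → xstar u = 1 → xstar v = 0 → u ∈ C ∨ v ∈ C) →
      ∑ v ∈ Finset.univ.filter (fun z : V => xstar z = 1), c v ≤ ∑ v ∈ C, c v := by
  refine ⟨fun u v _ hu _ => Or.inl (by simp [hu]), fun C hC => ?_⟩
  -- Round to `1/2` on `V₁ \ C` and on `V₀ ∩ C`.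
  let y : V → ℝ := fun v =>
    if (xstar v = 1 ∧ v ∉ C) ∨ (xstar v = 0 ∧ v ∈ C) then 1 / 2 else xstar v
  have hy_nonneg : ∀ v, 0 ≤ y v := by
    intro v
    dsimp only [y]
    split_ifs
    · norm_num
    · rcases hval v with h | h | h <;> norm_num [h]
  have hy_feas : ∀ u v : V, G.Adj u v → 1 ≤ y u + y v := by
    intro u v huv
    have hf := hfeas u v huv
    have huC := hC u v huv
    have hvC := hC v u huv.symm
    dsimp only [y]
    rcases hval u with hu | hu | hu <;> rcases hval v with hv | hv | hv <;>
      by_cases hu' : u ∈ C <;> by_cases hv' : v ∈ C <;>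
      simp [hu, hv, hu', hv'] at hf huC hvC ⊢ <;> linarith
  have hle := hopt y hy_nonneg hy_feas
  have hpt : ∀ v, (if xstar v = 1 then c v else 0) ≤
      (if v ∈ C then c v else 0) + 2 * (c v * xstar v - c v * y v) := by
    intro v
    have hcv := hc v
    dsimp only [y]
    rcases hval v with h | h | h <;> by_cases h' : v ∈ C <;> simp [h, h'] <;> linarith
  have hsum := Finset.sum_le_sum fun v (_ : v ∈ Finset.univ) => hpt v
  rw [Finset.sum_add_distrib, ← Finset.mul_sum, Finset.sum_sub_distrib,
    ← Finset.sum_filter, ← Finset.sum_filter, Finset.filter_univ_mem] at hsum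
  linarith
end

section
/- For all real numbers p and q with 0 ≤ p ≤ q ≤ 1, it holds that 2·(1 + p) ≤ (1 + √2)·(1 + p·q); equivalently (1 + p)/(1 + p·q) ≤ (1 + √2)/2, with equality at p = q = √2 − 1. -/
/-- The difference of the two sides at `q = p` is `(1 + √2)(p - (√2 - 1))²`. -/
theorem two_mul_one_add_le_one_add_sqrt_two_mul (p : ℝ) :
    2 * (1 + p) ≤ (1 + Real.sqrt 2) * (1 + p * p) := by
  have hs : Real.sqrt 2 ^ 2 = 2 := Real.sq_sqrt (by norm_num)
  have h : 0 ≤ (1 + Real.sqrt 2) * (p - (Real.sqrt 2 - 1)) ^ 2 := by positivity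
  linear_combination h - (2 * p + 1 - Real.sqrt 2) * hs

/-- For all real `p, q` with `0 ≤ p ≤ q ≤ 1`, one has
`2(1 + p) ≤ (1 + √2)(1 + pq)`; equivalently `(1 + p)/(1 + pq) ≤ (1 + √2)/2`, with
equality at `p = q = √2 − 1`. -/
theorem two_interval_ratio_bound :
    (∀ p q : ℝ, 0 ≤ p → p ≤ q → q ≤ 1 →
      2 * (1 + p) ≤ (1 + Real.sqrt 2) * (1 + p * q) ∧
      (1 + p) / (1 + p * q) ≤ (1 + Real.sqrt 2) / 2) ∧
    (1 + (Real.sqrt 2 - 1)) / (1 + (Real.sqrt 2 - 1) * (Real.sqrt 2 - 1)) =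
      (1 + Real.sqrt 2) / 2 := by
  refine ⟨fun p q hp hpq _ => ?_, ?_⟩
  · have hpp : p * p ≤ p * q := mul_le_mul_of_nonneg_left hpq hp
    have h : 2 * (1 + p) ≤ (1 + Real.sqrt 2) * (1 + p * q) :=
      (two_mul_one_add_le_one_add_sqrt_two_mul p).trans (by gcongr)
    have hpos : 0 < 1 + p * q := by nlinarith [mul_self_nonneg p]
    refine ⟨h, ?_⟩
    rw [div_le_div_iff₀ hpos two_pos]
    linarith
  · have hs : Real.sqrt 2 ^ 2 = 2 := Real.sq_sqrt (by norm_num)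
    have hpos : 0 < 1 + (Real.sqrt 2 - 1) * (Real.sqrt 2 - 1) := by
      nlinarith [mul_self_nonneg (Real.sqrt 2 - 1)]
    rw [div_eq_div_iff hpos.ne' two_ne_zero]
    linear_combination (1 - Real.sqrt 2) * hs
end

section
/- For all real numbers p, q, r with 0 ≤ p ≤ 1, 0 ≤ q ≤ 1, 0 ≤ r ≤ 1, if 1 + p·(2 − q) ≤ 2 + r + q − q·r, then 3·(1 + p·(2 − q)) ≤ 4·(1 + p + p·(1 − q)·r). -/
/-- For all real `p, q, r ∈ [0, 1]`, if `1 + p(2 − q) ≤ 2 + r + q − qr`, then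
`3(1 + p(2 − q)) ≤ 4(1 + p + p(1 − q)r)`. -/
theorem three_interval_case_L (p q r : ℝ)
    (hp₀ : 0 ≤ p) (hp₁ : p ≤ 1) (hq₀ : 0 ≤ q) (hq₁ : q ≤ 1) (hr₀ : 0 ≤ r) (hr₁ : r ≤ 1)
    (h : 1 + p * (2 - q) ≤ 2 + r + q - q * r) :
    3 * (1 + p * (2 - q)) ≤ 4 * (1 + p + p * (1 - q) * r) := by
  have hs : 0 ≤ p * (1 - q) * r := mul_nonneg (mul_nonneg hp₀ (sub_nonneg.2 hq₁)) hr₀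
  rcases le_total 0 (1 - 2 * p + 3 * p * q) with hA | hA
  · linarith
  · nlinarith [mul_le_mul_of_nonneg_left h hp₀, sq_nonneg (2 * p - 1),
      mul_nonneg (neg_nonneg.2 hA) (by linarith : 0 ≤ 1 + 4 * p)]
end

section
/- For all real numbers p, q, r with 0 ≤ p ≤ 1, 0 ≤ q ≤ 1, 0 ≤ r ≤ 1, if 2 + r + q − q·r ≤ 1 + p·(2 − q), then 3·(2 + r + q − q·r) ≤ 4·(1 + p + p·(1 − q)·r). -/
/-- For all real `p, q, r ∈ [0, 1]`, if `2 + r + q − qr ≤ 1 + p(2 − q)`, then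
`3(2 + r + q − qr) ≤ 4(1 + p + p(1 − q)r)`. -/
theorem three_interval_case_R (p q r : ℝ)
    (hp₀ : 0 ≤ p) (hp₁ : p ≤ 1) (hq₀ : 0 ≤ q) (hq₁ : q ≤ 1) (hr₀ : 0 ≤ r) (hr₁ : r ≤ 1)
    (h : 2 + r + q - q * r ≤ 1 + p * (2 - q)) :
    3 * (2 + r + q - q * r) ≤ 4 * (1 + p + p * (1 - q) * r) := by
  have hs : 0 ≤ r * (1 - q) := mul_nonneg hr₀ (sub_nonneg.2 hq₁)
  have hmul : 4 * (1 + q + r * (1 - q)) * (1 + r * (1 - q)) ≤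
      4 * (p * (2 - q)) * (1 + r * (1 - q)) := by
    gcongr
    linarith
  have hpos : 0 < 2 - q := by linarith
  refine le_of_mul_le_mul_right ?_ hpos
  nlinarith [mul_nonneg hq₀ hs, sq_nonneg (r * (1 - q)), sq_nonneg q]
end

section
/- Fix a natural number n ≥ 1 and a real ε ∈ (0, 1), and define A : ℕ → ℝ by A(1) = 1 + ε and A(k+1) = 1 + ε·(1 + ((n − 1)/n)·k) + (1 − ε)·A(k) for k ≥ 1. Then for every k ≥ 1, A(k) = k − k/n + (1 + 1/(n·ε))·(1 − (1 − ε)^k). -/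
/-- Fix `n ≥ 1` and `ε ∈ (0, 1)`, and let `A : ℕ → ℝ` satisfy `A 1 = 1 + ε` and
`A (k+1) = 1 + ε(1 + ((n − 1)/n)·k) + (1 − ε)·A k` for `k ≥ 1`.  Then for every
`k ≥ 1`, `A k = k − k/n + (1 + 1/(nε))·(1 − (1 − ε)^k)`. -/
theorem recurrence_closed_form (n : ℕ) (hn : 1 ≤ n) (ε : ℝ) (hε₀ : 0 < ε) (hε₁ : ε < 1)
    (A : ℕ → ℝ) (hA1 : A 1 = 1 + ε)
    (hArec : ∀ k : ℕ, 1 ≤ k →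
      A (k + 1) = 1 + ε * (1 + (((n : ℝ) - 1) / n) * k) + (1 - ε) * A k) :
    ∀ k : ℕ, 1 ≤ k →
      A k = (k : ℝ) - (k : ℝ) / n + (1 + 1 / (n * ε)) * (1 - (1 - ε) ^ k) := by
  have hn' : (n : ℝ) ≠ 0 := by
    exact_mod_cast (Nat.pos_of_ne_zero (by omega : n ≠ 0)).ne'
  have hε : ε ≠ 0 := hε₀.ne'
  intro k hk
  induction k, hk using Nat.le_induction with
  | base =>
    rw [hA1]
    push_cast
    field_simp
    ring
  | succ k hk ih =>
    rw [hArec k hk, ih, pow_succ]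
    push_cast
    field_simp
    ring
end

section
/- For every natural number n ≥ 1, as ε tends to 0 from the right, the quotient min(n, n − (1 − ε)^n + (1 − (1 − ε)^n)/(n·ε)) / (n − ((n − 1)/n)·(1 − ε)^n) tends to n²/(n² − n + 1). (In particular, n − (1 − ε)^n + (1 − (1 − ε)^n)/(n·ε) tends to n as ε → 0⁺.) -/
open Filter

/-- The chance `1 - (1 - ε)^n` that at least one of `n` independent events of probability `ε`
occurs is asymptotic to `n * ε`. -/
theorem tendsto_one_sub_one_sub_pow_div {n : ℕ} (hn : n ≠ 0) :
    Tendsto (fun ε : ℝ => (1 - (1 - ε) ^ n) / ((n : ℝ) * ε)) (nhdsWithin 0 {0}ᶜ) (nhds 1) := by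
  have hn' : (n : ℝ) ≠ 0 := Nat.cast_ne_zero.mpr hn
  have hcont : Continuous fun ε : ℝ => (∑ i ∈ Finset.range n, (1 - ε) ^ i) / (n : ℝ) := by
    fun_prop
  have hlim := (hcont.tendsto 0).mono_left (nhdsWithin_le_nhds (s := {0}ᶜ))
  simp only [sub_zero, one_pow, Finset.sum_const, Finset.card_range, nsmul_eq_mul, mul_one,
    div_self hn'] at hlim
  refine hlim.congr' ?_
  filter_upwards [self_mem_nhdsWithin] with ε (hε : ε ≠ 0)
  rw [← geom_sum_mul_neg, sub_sub_cancel, mul_div_mul_right _ _ hε]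

/-- For every `n ≥ 1`, as `ε → 0⁺`, the quotient
`min n (n − (1 − ε)^n + (1 − (1 − ε)^n)/(nε)) / (n − ((n − 1)/n)(1 − ε)^n)` tends to
`n²/(n² − n + 1)`.  In particular, `n − (1 − ε)^n + (1 − (1 − ε)^n)/(nε)` tends to `n`
as `ε → 0⁺`. -/
theorem single_hyperedge_lb_limit (n : ℕ) (hn : 1 ≤ n) :
    Tendsto
      (fun ε : ℝ =>
        min (n : ℝ) ((n : ℝ) - (1 - ε) ^ n + (1 - (1 - ε) ^ n) / ((n : ℝ) * ε)) /
          ((n : ℝ) - (((n : ℝ) - 1) / (n : ℝ)) * (1 - ε) ^ n))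
      (nhdsWithin 0 (Set.Ioi 0))
      (nhds ((n : ℝ) ^ 2 / ((n : ℝ) ^ 2 - (n : ℝ) + 1))) ∧
    Tendsto
      (fun ε : ℝ => (n : ℝ) - (1 - ε) ^ n + (1 - (1 - ε) ^ n) / ((n : ℝ) * ε))
      (nhdsWithin 0 (Set.Ioi 0)) (nhds (n : ℝ)) := by
  have hn' : (n : ℝ) ≠ 0 := Nat.cast_ne_zero.mpr (by lia)
  have hpow : Tendsto (fun ε : ℝ => (1 - ε) ^ n) (nhdsWithin 0 (Set.Ioi 0)) (nhds 1) := by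
    have hcont : Continuous fun ε : ℝ => (1 - ε) ^ n := by fun_prop
    simpa using (hcont.tendsto 0).mono_left nhdsWithin_le_nhds
  have hcost : Tendsto
      (fun ε : ℝ => (n : ℝ) - (1 - ε) ^ n + (1 - (1 - ε) ^ n) / ((n : ℝ) * ε))
      (nhdsWithin 0 (Set.Ioi 0)) (nhds (n : ℝ)) := by
    simpa using (hpow.const_sub (n : ℝ)).add
      ((tendsto_one_sub_one_sub_pow_div (by lia : n ≠ 0)).mono_left
        (nhdsWithin_mono 0 fun _ hε => ne_of_gt hε))
  refine ⟨?_, hcost⟩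
  have hne : (n : ℝ) ^ 2 - n + 1 ≠ 0 := by nlinarith [sq_nonneg ((n : ℝ) - 1)]
  have hden : (n : ℝ) - ((n : ℝ) - 1) / n * 1 = ((n : ℝ) ^ 2 - n + 1) / n := by
    field_simp
    ring
  have hden_ne : (n : ℝ) - ((n : ℝ) - 1) / n * 1 ≠ 0 := hden ▸ div_ne_zero hne hn'
  have hquot := ((tendsto_const_nhds (x := (n : ℝ))).min hcost).div
    ((hpow.const_mul (((n : ℝ) - 1) / n)).const_sub (n : ℝ)) hden_ne
  rw [min_self, hden, div_div_eq_mul_div, ← sq] at hquot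
  exact hquot
end

section
/- For all natural numbers n ≥ 1 and k ≥ 0, it holds that n/2^k + k·(1 − 1/2^k) ≥ (log₂ n)/4. -/
/-- For positive `x`, `log₂ x ≤ 2 x`. -/
lemma logb_two_le_two_mul {x : ℝ} (hx : 0 < x) : Real.logb 2 x ≤ 2 * x := by
  have h2 : (1 / 2 : ℝ) < Real.log 2 := by linarith [Real.log_two_gt_d9]
  rw [Real.logb, div_le_iff₀ (by linarith)]
  nlinarith [Real.log_le_sub_one_of_pos hx]

/-- For every natural number `k`, `k / 2 ≤ k (1 - 1 / 2 ^ k)`. -/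
lemma half_le_mul_one_sub_inv_two_pow (k : ℕ) :
    (k : ℝ) / 2 ≤ (k : ℝ) * (1 - 1 / 2 ^ k) := by
  rcases Nat.eq_zero_or_pos k with rfl | hk
  · simp
  · have h : (1 : ℝ) / 2 ^ k ≤ 1 / 2 := by
      have : (2 : ℝ) ≤ 2 ^ k := le_self_pow₀ one_le_two hk.ne'
      gcongr
    nlinarith [(Nat.cast_nonneg k : (0 : ℝ) ≤ k)]

/-- For all natural numbers `n ≥ 1` and `k ≥ 0`,
`n/2^k + k(1 − 1/2^k) ≥ (log₂ n)/4`. -/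
theorem two_stage_lb (n k : ℕ) (hn : 1 ≤ n) :
    Real.logb 2 n / 4 ≤ (n : ℝ) / 2 ^ k + (k : ℝ) * (1 - 1 / 2 ^ k) := by
  have hn' : (0 : ℝ) < n := by exact_mod_cast hn
  have hx : (0 : ℝ) < n / 2 ^ k := by positivity
  have hlog : Real.logb 2 ((n : ℝ) / 2 ^ k) = Real.logb 2 n - k := by
    rw [Real.logb_div hn'.ne' (by positivity), Real.logb_pow,
      Real.logb_self_eq_one one_lt_two, mul_one]
  have hk : (0 : ℝ) ≤ k := Nat.cast_nonneg k
  linarith [logb_two_le_two_mul hx, half_le_mul_one_sub_inv_two_pow k]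
end
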